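/- The twisted-linear pair is a Gelfand pair: Let 𝒌 be a finite field with q elements, q odd, of characteristic p, and R an algebraically closed field of characteristic different from p. Let m ≥ 1, fix a non-square α ∈ 𝒌^×, and let H = { [[x, y],[αy, x]] : x,y ∈ M_m(𝒌) } ∩ GL_{2m}(𝒌) ⊆ G = GL_{2m}(𝒌). Let (π,V) be an irreducible R-representation of G which is H-distinguished, i.e. admits a nonzero linear form Λ : V → R with Λ∘π(h) = Λ for all h ∈ H. Then the space of H-invariant linear forms on V is one-dimensional over R, and π is self-dual: π ≅ π^∨ as representations of G. -/

import Mathlib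

open Matrix
noncomputable section

namespace Stmt18

variable {k R V : Type*} [Field k] [Fintype k] [DecidableEq k] [Field R]
  [AddCommGroup V] [Module R V] {m : ℕ}

/-- Membership in the twisted-linear subgroup `H ≃ GL_m(𝒌(√α))` of `GL_{2m}(𝒌)`:
the invertible matrices of block form `[[x, y], [αy, x]]`. -/
def IsTwistedLinear (α : k) (h : GL (Fin m ⊕ Fin m) k) : Prop :=
  ∃ x y : Matrix (Fin m) (Fin m) k,
    (h : Matrix (Fin m ⊕ Fin m) (Fin m ⊕ Fin m) k) = Matrix.fromBlocks x y (α • y) x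

/-- The space of `H`-invariant linear forms on `V`, for `H` the set of elements of
`GL_{2m}(𝒌)` satisfying the predicate `P`. -/
def invForms (π : Representation R (GL (Fin m ⊕ Fin m) k) V)
    (P : GL (Fin m ⊕ Fin m) k → Prop) : Submodule R (Module.Dual R V) where
  carrier := {Λ | ∀ h, P h → ∀ v, Λ (π h v) = Λ v}
  add_mem' := by
    intro a b ha hb h hh v
    simp only [LinearMap.add_apply, ha h hh v, hb h hh v]
  zero_mem' := by intro h hh v; rfl
  smul_mem' := by
    intro c Λ hΛ h hh v
    simp only [LinearMap.smul_apply, hΛ h hh v]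

section Burnside

/-- **Burnside's theorem**: over an algebraically closed field, the algebra acting on a
finite-dimensional simple module surjects onto the full endomorphism algebra. -/
theorem exists_smul_eq_of_isSimpleModule {R A M : Type*} [Field R] [IsAlgClosed R] [Ring A]
    [Algebra R A] [AddCommGroup M] [Module R M] [Module A M] [IsScalarTower R A M]
    [FiniteDimensional R M] [IsSimpleModule A M] (T : Module.End R M) :
    ∃ a : A, ∀ v, T v = a • v := by
  have hs := (IsSimpleModule.algebraMap_end_bijective_of_isAlgClosed (A := A) (V := M) R).2
  let f : Module.End (Module.End A M) M :=
    { toFun := T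
      map_add' := T.map_add
      map_smul' := by
        intro x v
        obtain ⟨c, rfl⟩ := hs x
        simp }
  classical
  obtain ⟨a, ha⟩ := jacobson_density (R := A) f
    (Finset.univ.image (Module.finBasis R M))
  refine ⟨a, fun v => ?_⟩
  have : T = Algebra.lsmul R R M a := by
    refine (Module.finBasis R M).ext fun i => ?_
    simpa [f] using ha (Module.finBasis R M i) (by simp)
  rw [this]; rfl

/-- The operators of an irreducible representation span the endomorphism algebra. -/
theorem linearCombination_surjective_of_irreducible {R G V : Type*} [Field R] [IsAlgClosed R]
    [Group G] [AddCommGroup V] [Module R V] [FiniteDimensional R V] (π : Representation R G V)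
    (hV : ∃ v : V, v ≠ 0)
    (hirr : ∀ W : Submodule R V, (∀ g : G, ∀ v ∈ W, π g v ∈ W) → W = ⊥ ∨ W = ⊤) :
    Function.Surjective (Finsupp.linearCombination R (fun g => π g)) := by
  intro T
  let _ : Module (MonoidAlgebra R G) V := Module.compHom V π.asAlgebraHom.toRingHom
  have hsmul (a : MonoidAlgebra R G) (v : V) : a • v = π.asAlgebraHom a v := rfl
  have : IsScalarTower R (MonoidAlgebra R G) V := ⟨fun r a v => by simp [hsmul]⟩
  have : Nontrivial V := let ⟨v, hv⟩ := hV; ⟨v, 0, hv⟩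
  have : IsSimpleModule (MonoidAlgebra R G) V :=
    { eq_bot_or_eq_top := by
        intro W
        have := hirr (W.restrictScalars R) (fun g v hv => by
          have := W.smul_mem (MonoidAlgebra.single g 1) hv
          simpa [hsmul] using this)
        simpa using this }
  obtain ⟨a, ha⟩ := exists_smul_eq_of_isSimpleModule (A := MonoidAlgebra R G) T
  have : π.asAlgebraHom a = T := LinearMap.ext fun v => (ha v).symm
  rw [Representation.asAlgebraHom_def, MonoidAlgebra.lift_apply] at this
  exact ⟨a.coeff, this⟩
end Burnside

section InvariantVectors
variable {R G V : Type*} [Field R] [Group G] [AddCommGroup V] [Module R V]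

theorem linearCombination_comp_eq_zero [FiniteDimensional R V] (π : Representation R G V)
    (hspan : Function.Surjective (Finsupp.linearCombination R (fun g => π g)))
    {θ : G → G} (hmul : ∀ x y, θ (x * y) = θ y * θ x) (hinv : ∀ x, θ (θ x) = x)
    (htr : ∀ g, LinearMap.trace R V (π (θ g)) = LinearMap.trace R V (π g))
    {f : G →₀ R} (hf : Finsupp.linearCombination R (fun g => π g) f = 0) :
    Finsupp.linearCombination R (fun g => π (θ g)) f = 0 := by
  set S := Finsupp.linearCombination R (fun g => π (θ g)) f with hS
  have key (x : G) : LinearMap.trace R V (S * π x) = 0 := by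
    have h1 : ∀ g, LinearMap.trace R V (π (θ g) * π x) =
        LinearMap.trace R V (π (θ x) * π g) := fun g => by
      rw [← map_mul, ← map_mul, ← htr (θ x * g), hmul, hinv]
    have h2 : LinearMap.trace R V (π (θ x) * Finsupp.linearCombination R (fun g => π g) f) = 0 := by
      rw [hf, mul_zero, map_zero]
    rw [← h2, hS, Finsupp.linearCombination_apply, Finsupp.linearCombination_apply,
      Finsupp.sum, Finsupp.sum, Finset.sum_mul, Finset.mul_sum, map_sum, map_sum]
    refine Finset.sum_congr rfl fun g _ => ?_
    rw [smul_mul_assoc, mul_smul_comm, map_smul, map_smul, h1]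
  have key2 (T : Module.End R V) : LinearMap.trace R V (S * T) = 0 := by
    obtain ⟨a, rfl⟩ := hspan T
    rw [Finsupp.linearCombination_apply, Finsupp.sum, Finset.mul_sum, map_sum]
    refine Finset.sum_eq_zero fun g _ => ?_
    rw [mul_smul_comm, map_smul, key, smul_zero]
  ext v
  rw [LinearMap.zero_apply, ← Module.forall_dual_apply_eq_zero_iff R]
  intro l
  have := key2 (l.smulRight v)
  rwa [show S * l.smulRight v = l.smulRight (S v) by ext; simp,
    LinearMap.trace_smulRight] at this

/-- If an involutive anti-automorphism `θ` preserves the character of an irreducible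
representation, an `H`-invariant linear form yields a `θ(H)`-invariant vector. -/
theorem exists_invariant_vector [FiniteDimensional R V] (π : Representation R G V)
    (hspan : Function.Surjective (Finsupp.linearCombination R (fun g => π g)))
    {θ : G → G} (hmul : ∀ x y, θ (x * y) = θ y * θ x) (hinv : ∀ x, θ (θ x) = x)
    (htr : ∀ g, LinearMap.trace R V (π (θ g)) = LinearMap.trace R V (π g))
    {P : G → Prop} {Λ : Module.Dual R V} (hΛ : Λ ≠ 0) (hP : ∀ h, P h → ∀ v, Λ (π h v) = Λ v) :
    ∃ w : V, w ≠ 0 ∧ ∀ h, P h → π (θ h) w = w := by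
  obtain ⟨v, hv⟩ : ∃ v, Λ v ≠ 0 := by
    by_contra! h
    exact hΛ (LinearMap.ext h)
  obtain ⟨f, hf⟩ := hspan (Λ.smulRight v)
  set S := Finsupp.linearCombination R (fun g => π (θ g)) f with hS
  have hS0 : S ≠ 0 := by
    intro h0
    have := linearCombination_comp_eq_zero π hspan hmul hinv htr
      (f := Finsupp.mapDomain θ f) (by
        rw [Finsupp.linearCombination_mapDomain]; exact h0)
    rw [Finsupp.linearCombination_mapDomain] at this
    have h3 : (fun g => π (θ g)) ∘ θ = fun g => π g := by
      funext g; simp [hinv]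
    rw [h3, hf] at this
    have := LinearMap.congr_fun this v
    simp only [LinearMap.smulRight_apply, LinearMap.zero_apply, smul_eq_zero] at this
    rcases this with h | h
    · exact hv h
    · exact hv (by rw [h, map_zero])
  obtain ⟨u, hu⟩ : ∃ u, S u ≠ 0 := by
    by_contra! h
    exact hS0 (LinearMap.ext h)
  refine ⟨S u, hu, fun h hh => ?_⟩
  have h1 := linearCombination_comp_eq_zero π hspan hmul hinv htr
    (f := Finsupp.mapDomain (· * h) f - f) (by
      have h2 : Finsupp.linearCombination R ((fun g => π g) ∘ (· * h)) f =
          Finsupp.linearCombination R (fun g => π g) f * π h := by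
        rw [Finsupp.linearCombination_apply, Finsupp.linearCombination_apply, Finsupp.sum,
          Finsupp.sum, Finset.sum_mul]
        refine Finset.sum_congr rfl fun g _ => ?_
        simp
      rw [map_sub, Finsupp.linearCombination_mapDomain, h2, hf, sub_eq_zero]
      ext x
      simp [hP h hh])
  have h2 : Finsupp.linearCombination R ((fun g => π (θ g)) ∘ (· * h)) f = π (θ h) * S := by
    rw [hS, Finsupp.linearCombination_apply, Finsupp.linearCombination_apply, Finsupp.sum,
      Finsupp.sum, Finset.mul_sum]
    refine Finset.sum_congr rfl fun g _ => ?_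
    simp [hmul]
  rw [map_sub, Finsupp.linearCombination_mapDomain, h2, sub_eq_zero] at h1
  exact LinearMap.congr_fun h1 u

theorem apply_linearCombination_orbit (π : Representation R G V) (v : V) (g : G) (f : G →₀ R) :
    π g (Finsupp.linearCombination R (fun x => π x v) f) =
      Finsupp.linearCombination R (fun x => π x v) (Finsupp.mapDomain (g * ·) f) := by
  rw [Finsupp.linearCombination_mapDomain, Finsupp.linearCombination_apply,
    Finsupp.linearCombination_apply, Finsupp.sum, Finsupp.sum, map_sum]
  refine Finset.sum_congr rfl fun x _ => ?_
  simp

/-- An irreducible representation whose matrix coefficient attached to a nonzero vector `w` and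
a nonzero form `Λ` is invariant under inversion is self-dual, by an isomorphism sending `w`
to `Λ`. -/
theorem exists_equiv_dual [FiniteDimensional R V] (π : Representation R G V)
    (hirr : ∀ W : Submodule R V, (∀ g : G, ∀ v ∈ W, π g v ∈ W) → W = ⊥ ∨ W = ⊤)
    {w : V} (hw : w ≠ 0) {Λ : Module.Dual R V} (hΛ : Λ ≠ 0)
    (hsymm : ∀ g, Λ (π g w) = Λ (π g⁻¹ w)) :
    ∃ e : V ≃ₗ[R] Module.Dual R V, (∀ g v, e (π g v) = π.dual g (e v)) ∧ e w = Λ := by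
  set L₁ := Finsupp.linearCombination R (fun x => π x w) with hL₁
  set L₂ := Finsupp.linearCombination R (fun x => π.dual x Λ) with hL₂
  have hsurj : LinearMap.range L₁ = ⊤ := by
    refine (hirr _ ?_).resolve_left ?_
    · rintro g _ ⟨f, rfl⟩
      exact ⟨_, (apply_linearCombination_orbit π w g f).symm⟩
    · intro h
      have : L₁ (Finsupp.single 1 1) ∈ LinearMap.range L₁ := ⟨_, rfl⟩
      rw [h] at this
      simp [hL₁] at this
      exact hw this
  have hker : ∀ f, L₁ f = 0 → L₂ f = 0 := by
    intro f hf
    ext v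
    obtain ⟨a, rfl⟩ := LinearMap.range_eq_top.1 hsurj v
    have key (x : G) : L₂ f (π x w) = 0 := by
      have h0 : Λ (π x⁻¹ (L₁ f)) = 0 := by rw [hf, map_zero, map_zero]
      rw [← h0, hL₁, hL₂, Finsupp.linearCombination_apply, Finsupp.linearCombination_apply,
        Finsupp.sum, Finsupp.sum, map_sum, map_sum, LinearMap.sum_apply]
      refine Finset.sum_congr rfl fun g _ => ?_
      rw [LinearMap.smul_apply, map_smul, map_smul]
      congr 1
      rw [Representation.dual_apply, Module.Dual.transpose_apply, LinearMap.comp_apply,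
        ← Module.End.mul_apply, ← Module.End.mul_apply, ← map_mul, ← map_mul, hsymm]
      simp
    have h0 : L₂ f ∘ₗ L₁ = 0 := Finsupp.lhom_ext fun x r => by
      simp only [LinearMap.comp_apply, hL₁, Finsupp.linearCombination_single, map_smul, key,
        smul_zero, LinearMap.zero_apply]
    exact LinearMap.congr_fun h0 a
  obtain ⟨s, hs⟩ := L₁.exists_rightInverse_of_surjective hsurj
  have hs' (v) : L₁ (s v) = v := LinearMap.congr_fun hs v
  have hE (f) : (L₂ ∘ₗ s) (L₁ f) = L₂ f := by
    rw [LinearMap.comp_apply, ← sub_eq_zero, ← map_sub]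
    exact hker _ (by rw [map_sub, hs', sub_self])
  have hEG (g v) : (L₂ ∘ₗ s) (π g v) = π.dual g ((L₂ ∘ₗ s) v) := by
    obtain ⟨f, rfl⟩ := LinearMap.range_eq_top.1 hsurj v
    rw [apply_linearCombination_orbit π, hE, hE, hL₂, apply_linearCombination_orbit π.dual]
  have hEw : (L₂ ∘ₗ s) w = Λ := by
    have := hE (Finsupp.single 1 1)
    rwa [hL₁, hL₂, Finsupp.linearCombination_single, Finsupp.linearCombination_single, one_smul,
      one_smul, map_one, map_one, Module.End.one_apply, Module.End.one_apply] at this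
  have hinj : LinearMap.ker (L₂ ∘ₗ s) = ⊥ := by
    refine (hirr _ ?_).resolve_right ?_
    · intro g v hv
      rw [LinearMap.mem_ker] at hv ⊢
      rw [hEG, hv, map_zero]
    · intro h
      rw [LinearMap.ker_eq_top.1 h] at hEw
      exact hΛ hEw.symm
  exact ⟨LinearEquiv.ofInjectiveOfFinrankEq _ (LinearMap.ker_eq_bot.1 hinj)
    Subspace.dual_finrank_eq.symm, hEG, hEw⟩

/-- Schur's lemma for isomorphisms onto another representation. -/
theorem exists_smul_eq_of_equivariant [IsAlgClosed R] [FiniteDimensional R V]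
    (π : Representation R G V) (hV : ∃ v : V, v ≠ 0)
    (hirr : ∀ W : Submodule R V, (∀ g : G, ∀ v ∈ W, π g v ∈ W) → W = ⊥ ∨ W = ⊤)
    {M : Type*} [AddCommGroup M] [Module R M] (σ : Representation R G M) (e₁ e₂ : V ≃ₗ[R] M)
    (h₁ : ∀ g v, e₁ (π g v) = σ g (e₁ v)) (h₂ : ∀ g v, e₂ (π g v) = σ g (e₂ v)) :
    ∃ c : R, ∀ v, e₁ v = c • e₂ v := by
  have : Nontrivial V := let ⟨v, hv⟩ := hV; ⟨v, 0, hv⟩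
  obtain ⟨c, hc⟩ := Module.End.exists_eigenvalue (e₂.symm.toLinearMap ∘ₗ e₁.toLinearMap)
  have htop := (hirr (Module.End.eigenspace (e₂.symm.toLinearMap ∘ₗ e₁.toLinearMap) c) (by
    intro g v hv
    rw [Module.End.mem_eigenspace_iff] at hv ⊢
    apply e₂.injective
    have hv' := congrArg e₂ hv
    simp only [LinearMap.comp_apply, LinearEquiv.coe_coe, LinearEquiv.apply_symm_apply,
      map_smul] at hv' ⊢
    rw [h₁, h₂, hv', map_smul])).resolve_left hc
  refine ⟨c, fun v => ?_⟩
  have hv : v ∈ Module.End.eigenspace (e₂.symm.toLinearMap ∘ₗ e₁.toLinearMap) c :=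
    htop ▸ Submodule.mem_top
  rw [Module.End.mem_eigenspace_iff] at hv
  simpa using congrArg e₂ hv

end InvariantVectors

section Transpose

open Polynomial DirectSum

theorem exists_dual_detecting_of_irreducible_pow {k : Type*} [Field k] {p : k[X]}
    (hp : Irreducible p) (e : ℕ) :
    ∃ l : (k[X] ⧸ Submodule.span k[X] {p ^ e}) →ₗ[k] k,
      ∀ x, (∀ a : k[X], l (a • x) = 0) → x = 0 := by
  classical
  rcases Nat.eq_zero_or_pos e with rfl | he
  · refine ⟨0, fun x _ => ?_⟩
    obtain ⟨x, rfl⟩ := Submodule.Quotient.mk_surjective _ x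
    rw [Submodule.Quotient.mk_eq_zero, Submodule.mem_span_singleton]
    exact ⟨x, by simp⟩
  set z : k[X] ⧸ Submodule.span k[X] {p ^ e} := Submodule.Quotient.mk (p ^ (e - 1)) with hz
  have hz0 : z ≠ 0 := by
    rw [hz, Ne, Submodule.Quotient.mk_eq_zero]
    intro h
    have := Ideal.mem_span_singleton.1 h
    rw [pow_dvd_pow_iff hp.ne_zero hp.not_isUnit] at this
    omega
  obtain ⟨l, hl⟩ : ∃ l : Module.Dual k (k[X] ⧸ Submodule.span k[X] {p ^ e}), l z ≠ 0 := by
    by_contra! h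
    exact hz0 ((Module.forall_dual_apply_eq_zero_iff k z).1 h)
  refine ⟨l, fun x hx => ?_⟩
  by_contra hx0
  obtain ⟨f, rfl⟩ := Submodule.Quotient.mk_surjective _ x
  have hf : ¬ p ^ e ∣ f := fun h => hx0 ((Submodule.Quotient.mk_eq_zero _).2
    (Ideal.mem_span_singleton.2 h))
  obtain ⟨j, hj, hassoc⟩ := (dvd_prime_pow hp.prime e).1 (EuclideanDomain.gcd_dvd_right f (p ^ e))
  have hje : j < e := by
    refine lt_of_le_of_ne hj fun h => hf ?_
    rw [h] at hassoc
    exact hassoc.symm.dvd.trans (EuclideanDomain.gcd_dvd_left f (p ^ e))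
  have hdvd : EuclideanDomain.gcd f (p ^ e) ∣ p ^ (e - 1) :=
    hassoc.dvd.trans (pow_dvd_pow p (by omega))
  obtain ⟨c, hc⟩ := hdvd
  rw [EuclideanDomain.gcd_eq_gcd_ab] at hc
  have hza : z = (EuclideanDomain.gcdA f (p ^ e) * c) • Submodule.Quotient.mk f := by
    rw [hz, ← Submodule.Quotient.mk_smul, Submodule.Quotient.eq]
    refine Ideal.mem_span_singleton.2 ⟨EuclideanDomain.gcdB f (p ^ e) * c, ?_⟩
    rw [hc, smul_eq_mul]; ring
  exact hl (by rw [hza]; exact hx _)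

/-- Every endomorphism of a finite-dimensional vector space is self-adjoint for some
nondegenerate bilinear form. -/
theorem exists_equiv_dual_selfAdjoint {k M : Type*} [Field k] [AddCommGroup M] [Module k M]
    [FiniteDimensional k M] (A : Module.End k M) :
    ∃ B : M ≃ₗ[k] Module.Dual k M, ∀ x y, B (A x) y = B x (A y) := by
  classical
  obtain ⟨ι, _, p, hp, e, ⟨E⟩⟩ := Module.equiv_directSum_of_isTorsion (R := k[X])
    (M := Module.AEval' A) (Module.AEval.isTorsion_of_finiteDimensional k M A)
  choose l hl using fun i => exists_dual_detecting_of_irreducible_pow (hp i) (e i)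
  let E' : M →ₗ[k] ⨁ i : ι, k[X] ⧸ Submodule.span k[X] {p i ^ e i} :=
    (E.restrictScalars k).toLinearMap ∘ₗ (Module.AEval'.of A).toLinearMap
  have hE' : Function.Bijective E' := E.bijective.comp (Module.AEval'.of A).bijective
  have hEA (x : M) : E' (A x) = (X : k[X]) • E' x := by
    simp [E', ← Module.AEval'.X_smul_of]
  let b (i : ι) : (k[X] ⧸ Submodule.span k[X] {p i ^ e i}) →ₗ[k]
      (k[X] ⧸ Submodule.span k[X] {p i ^ e i}) →ₗ[k] k :=
    (LinearMap.mul k (k[X] ⧸ Ideal.span {p i ^ e i})).compr₂ (l i)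
  let c (i : ι) : (⨁ i : ι, k[X] ⧸ Submodule.span k[X] {p i ^ e i}) →ₗ[k]
      (k[X] ⧸ Submodule.span k[X] {p i ^ e i}) := DirectSum.component k ι _ i
  let B : M →ₗ[k] Module.Dual k M := ∑ i, (b i).compl₁₂ (c i ∘ₗ E') (c i ∘ₗ E')
  have hB (x y) : B x y = ∑ i, b i (E' x i) (E' y i) := by
    simp [B, c]; rfl
  have hb (i : ι) (a : k[X]) (x y) : b i (a • x) y = b i x (a • y) := by
    simp only [b, LinearMap.compr₂_apply, LinearMap.mul_apply_apply]
    rw [smul_mul_assoc, mul_smul_comm]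
  have hinj : LinearMap.ker B = ⊥ := by
    rw [LinearMap.ker_eq_bot']
    intro x hx
    have h0 : ∀ i, E' x i = 0 := fun i => by
      refine hl i _ fun a => ?_
      obtain ⟨y, hy⟩ := hE'.2 (DirectSum.of (fun i => k[X] ⧸ Submodule.span k[X] {p i ^ e i}) i
        (Submodule.Quotient.mk a))
      have h1 := LinearMap.congr_fun hx y
      rw [hB, hy, Finset.sum_eq_single i] at h1
      · rw [DirectSum.of_eq_same] at h1
        have h2 : (Submodule.Quotient.mk a : k[X] ⧸ Submodule.span k[X] {p i ^ e i}) =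
          a • (1 : k[X] ⧸ Ideal.span {p i ^ e i}) := by
          change _ = a • Submodule.Quotient.mk (1 : k[X])
          rw [← Submodule.Quotient.mk_smul, smul_eq_mul, mul_one]
        rw [h2, ← hb] at h1
        simpa [b] using h1
      · intro j _ hj
        rw [DirectSum.of_eq_of_ne _ _ _ hj, map_zero]
      · simp
    exact hE'.1 (by ext i; rw [h0 i, map_zero]; rfl)
  refine ⟨LinearEquiv.ofInjectiveOfFinrankEq B (LinearMap.ker_eq_bot.1 hinj)
    Subspace.dual_finrank_eq.symm, fun x y => ?_⟩
  change B (A x) y = B x (A y)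
  simp only [hB, hEA, DirectSum.smul_apply, hb]

end Transpose

section AntiCommuting

variable {k M : Type*} [Field k] [AddCommGroup M] [Module k M]

/-- An endomorphism whose square is a non-square scalar anticommutes with some involution. -/
theorem exists_involutive_anticommuting [FiniteDimensional k M] {β : k} (hβ : ¬ IsSquare β)
    (e : Module.End k M) (he : ∀ x, e (e x) = β • x) :
    ∃ t : Module.End k M, (∀ x, t (t x) = x) ∧ ∀ x, t (e x) = - e (t x) := by
  obtain ⟨U, hU, hmax⟩ := (wellFounded_gt (α := Submodule k M)).has_min
    {U | Disjoint U (U.map e)} ⟨⊥, disjoint_bot_left⟩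
  have heW : ∀ y ∈ U ⊔ U.map e, e y ∈ U ⊔ U.map e := by
    intro y hy
    obtain ⟨u, hu, z, hz, rfl⟩ := Submodule.mem_sup.1 hy
    obtain ⟨u', hu', rfl⟩ := hz
    rw [map_add, he, add_comm]
    exact Submodule.add_mem_sup (U.smul_mem _ hu') (Submodule.mem_map_of_mem hu)
  have htop : U ⊔ U.map e = ⊤ := by
    by_contra hne
    obtain ⟨v, hv⟩ : ∃ v, v ∉ U ⊔ U.map e := by
      by_contra! h
      exact hne (eq_top_iff.2 fun x _ => h x)
    refine hmax (U ⊔ Submodule.span k {v}) ?_ ?_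
    · rw [Set.mem_ofPred_eq, Submodule.disjoint_def]
      rintro x hx ⟨z, hz, rfl⟩
      obtain ⟨u, hu, _, hav, hx⟩ := Submodule.mem_sup.1 hx
      obtain ⟨a, rfl⟩ := Submodule.mem_span_singleton.1 hav
      obtain ⟨u', hu', _, hbv, rfl⟩ := Submodule.mem_sup.1 hz
      obtain ⟨b, rfl⟩ := Submodule.mem_span_singleton.1 hbv
      have hy : a • v - b • e v ∈ U ⊔ U.map e := by
        have : a • v - b • e v = - u + e u' := by
          rw [map_add, map_smul] at hx
          have h' : a • v = e u' + b • e v - u := by rw [← hx]; abel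
          rw [h']; abel
        rw [this]
        exact Submodule.add_mem_sup (U.neg_mem hu) (Submodule.mem_map_of_mem hu')
      have hv2 : (a ^ 2 - b ^ 2 * β) • v ∈ U ⊔ U.map e := by
        have : (a ^ 2 - b ^ 2 * β) • v = a • (a • v - b • e v) + b • e (a • v - b • e v) := by
          rw [map_sub, map_smul, map_smul, he]
          module
        rw [this]
        exact add_mem (Submodule.smul_mem _ _ hy) (Submodule.smul_mem _ _ (heW _ hy))
      have hab : a ^ 2 - b ^ 2 * β = 0 := by
        by_contra h
        exact hv ((Submodule.smul_mem_iff _ h).1 hv2)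
      have hb : b = 0 := by
        by_contra h
        refine hβ ⟨a / b, ?_⟩
        field_simp
        linear_combination -hab
      have ha : a = 0 := by
        rw [hb] at hab
        simpa using hab
      rw [ha, hb, zero_smul, add_zero, add_zero] at hx
      rw [hb, zero_smul, add_zero]
      exact (Submodule.disjoint_def.1 hU) _ (hx ▸ hu) (Submodule.mem_map_of_mem hu')
    · refine lt_of_le_of_ne le_sup_left fun h => hv ?_
      have : v ∈ U := by
        rw [h]
        exact Submodule.mem_sup_right (Submodule.mem_span_singleton_self v)
      exact Submodule.mem_sup_left this
  have hc : IsCompl U (U.map e) := ⟨hU, codisjoint_iff.2 htop⟩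
  have hdec (x : M) : ∃ u ∈ U, ∃ w ∈ U, x = u + e w := by
    have hx : x ∈ U ⊔ U.map e := htop ▸ Submodule.mem_top
    obtain ⟨u, hu, _, ⟨w, hw, rfl⟩, rfl⟩ := Submodule.mem_sup.1 hx
    exact ⟨u, hu, w, hw, rfl⟩
  set t : Module.End k M := U.projection _ hc - (U.map e).projection _ hc.symm with ht
  have hu {u} (hu : u ∈ U) : t u = u := by
    rw [ht, LinearMap.sub_apply, Submodule.projection_apply_of_mem_left _ hu,
      Submodule.projection_apply_of_mem_right _ hu, sub_zero]
  have hw {w} (hw : w ∈ U) : t (e w) = - e w := by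
    have hw' : e w ∈ U.map e := Submodule.mem_map_of_mem hw
    rw [ht, LinearMap.sub_apply, Submodule.projection_apply_of_mem_left _ hw',
      Submodule.projection_apply_of_mem_right _ hw', zero_sub]
  refine ⟨t, fun x => ?_, fun x => ?_⟩
  · obtain ⟨u, hu', w, hw', rfl⟩ := hdec x
    simp only [map_add, map_neg, hu hu', hw hw', neg_neg]
  · obtain ⟨u, hu', w, hw', rfl⟩ := hdec x
    simp only [map_add, map_neg, map_smul, hu hu', hw hw', he, hu hw', hw hu', neg_neg, neg_add]

/-- A linear map turned into one anticommuting with `e`, by averaging. -/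
theorem exists_anticommuting_average {β : k} (hβ : β ≠ 0)
    (e : Module.End k M) (he : ∀ x, e (e x) = β • x) (f : Module.End k M) :
    ∃ g : Module.End k M, (∀ x, g (e x) = - e (g x)) ∧
      ∀ x, g x = (2 : k)⁻¹ • (f x - β⁻¹ • e (f (e x))) := by
  refine ⟨(2 : k)⁻¹ • (f - β⁻¹ • (e ∘ₗ f ∘ₗ e)), fun x => ?_, fun x => by simp⟩
  simp only [LinearMap.smul_apply, LinearMap.sub_apply, LinearMap.comp_apply, he, map_smul,
    map_sub, smul_sub, smul_smul]
  rw [mul_assoc, inv_mul_cancel₀ hβ, mul_one]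
  abel

theorem exists_isCompl_mem_invtSubmodule [FiniteDimensional k M] (h2 : (2 : k) ≠ 0) {β : k}
    (hβ : β ≠ 0) (e : Module.End k M) (he : ∀ x, e (e x) = β • x) {p : Submodule k M}
    (hp : ∀ x ∈ p, e x ∈ p) : ∃ q : Submodule k M, (∀ x ∈ q, e x ∈ q) ∧ IsCompl p q := by
  have hs : e.IsSemisimple := by
    refine Module.End.isSemisimple_of_squarefree_aeval_eq_zero
      (p := Polynomial.X ^ 2 - Polynomial.C β)
      (Polynomial.separable_X_pow_sub_C β (by exact_mod_cast h2) hβ).squarefree ?_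
    ext x
    simp [pow_two, he]
  exact Module.End.isSemisimple_iff.1 hs p hp

end AntiCommuting

section Swap

universe u v

/-- If `e² = β` is a non-square scalar and `c` anticommutes with `e`, then some automorphism
commutes with `c` and anticommutes with `e`. -/
theorem exists_commuting_anticommuting {k : Type u} [Field k] (h2 : (2 : k) ≠ 0) {β : k}
    (hβ : ¬ IsSquare β) (n : ℕ) :
    ∀ (M : Type v) [AddCommGroup M] [Module k M] [FiniteDimensional k M] (e c : Module.End k M),
      Module.finrank k M = n → (∀ x, e (e x) = β • x) → (∀ x, c (e x) = - e (c x)) →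
      ∃ t : Module.End k M, Function.Injective t ∧ (∀ x, t (c x) = c (t x)) ∧
        ∀ x, t (e x) = - e (t x) := by
  have hβ0 : β ≠ 0 := fun h => hβ (h ▸ IsSquare.zero)
  induction n using Nat.strong_induction_on with | _ n ih =>
  intro M _ _ _ e c hn he hce
  by_cases hsurj : LinearMap.range c = ⊤
  · exact ⟨c, LinearMap.injective_iff_surjective.2 (LinearMap.range_eq_top.1 hsurj),
      fun _ => rfl, hce⟩
  set N := LinearMap.range c with hN
  set K := LinearMap.ker c with hK
  have heN : ∀ x ∈ N, e x ∈ N := by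
    rintro _ ⟨y, rfl⟩
    exact ⟨- e y, by rw [map_neg, hce, neg_neg]⟩
  have heK : ∀ x ∈ K, e x ∈ K := fun x hx => by
    rw [hK, LinearMap.mem_ker] at hx ⊢
    rw [hce, hx, map_zero, neg_zero]
  have hcN : ∀ x ∈ N, c x ∈ N := fun x _ => ⟨x, rfl⟩
  obtain ⟨t₀, ht₀inj, ht₀c, ht₀e⟩ := ih (Module.finrank k N)
    (hn ▸ Submodule.finrank_lt hsurj) N (e.restrict heN) (c.restrict hcN) rfl
    (fun x => Subtype.ext (he x)) (fun x => Subtype.ext (hce x))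
  have ht₀c' (x : N) : (t₀ ⟨c x, hcN x x.2⟩ : M) = c (t₀ x) := congrArg Subtype.val (ht₀c x)
  have ht₀e' (x : N) : (t₀ ⟨e x, heN x x.2⟩ : M) = - e (t₀ x) := congrArg Subtype.val (ht₀e x)
  -- An extension of `t₀` anticommuting with `e`.
  obtain ⟨f, hf⟩ := LinearMap.exists_extend (N.subtype ∘ₗ t₀)
  have hf' (x) (hx : x ∈ N) : f x = t₀ ⟨x, hx⟩ := LinearMap.congr_fun hf ⟨x, hx⟩
  obtain ⟨T₁, hT₁e, hT₁⟩ := exists_anticommuting_average hβ0 e he f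
  have hT₁N (x) (hx : x ∈ N) : T₁ x = t₀ ⟨x, hx⟩ := by
    rw [hT₁, hf' x hx, hf' _ (heN x hx), ht₀e' ⟨x, hx⟩, map_neg, he, smul_neg, sub_neg_eq_add,
      inv_smul_smul₀ hβ0, ← two_smul k, inv_smul_smul₀ h2]
  -- The correction making it commute with `c`.
  set γ : Module.End k M := T₁ ∘ₗ c - c ∘ₗ T₁ with hγ
  have hγx (x) : γ x = T₁ (c x) - c (T₁ x) := rfl
  have hγN (x) : γ x ∈ N := by
    rw [hγx, hT₁N (c x) ⟨x, rfl⟩]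
    exact sub_mem (t₀ _).2 ⟨_, rfl⟩
  have hγ0 (x) (hx : x ∈ N) : γ x = 0 := by
    rw [hγx, hT₁N x hx, hT₁N (c x) (hcN x hx), ht₀c' ⟨x, hx⟩, sub_self]
  have hγe (x) : γ (e x) = e (γ x) := by
    rw [hγx, hγx, hce, map_neg, hT₁e, hT₁e, map_neg, hce, map_sub]
    abel
  obtain ⟨s, hs⟩ := c.rangeRestrict.exists_rightInverse_of_surjective c.range_rangeRestrict
  have hs' (y : N) : c (s y) = y := congrArg Subtype.val (LinearMap.congr_fun hs y)
  set δ₀ : Module.End k M := s ∘ₗ γ.codRestrict N hγN with hδ₀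
  have hcδ₀ (x) : c (δ₀ x) = γ x := hs' ⟨γ x, hγN x⟩
  have hδ₀N (x) (hx : x ∈ N) : δ₀ x = 0 := by
    have : γ.codRestrict N hγN x = 0 := Subtype.ext (hγ0 x hx)
    rw [hδ₀, LinearMap.comp_apply, this, map_zero]
  obtain ⟨δ, hδe, hδ⟩ := exists_anticommuting_average hβ0 e he δ₀
  have hδN (x) (hx : x ∈ N) : δ x = 0 := by
    rw [hδ, hδ₀N x hx, hδ₀N _ (heN x hx), map_zero, smul_zero, sub_zero, smul_zero]
  have hcδ (x) : c (δ x) = γ x := by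
    rw [hδ, map_smul, map_sub, map_smul, hcδ₀, hce, hcδ₀, hγe, he, smul_neg, sub_neg_eq_add,
      inv_smul_smul₀ hβ0, ← two_smul k, inv_smul_smul₀ h2]
  set T : Module.End k M := T₁ + δ with hT
  have hTN (x) (hx : x ∈ N) : T x = t₀ ⟨x, hx⟩ := by
    rw [hT, LinearMap.add_apply, hT₁N x hx, hδN x hx, add_zero]
  have hTe (x) : T (e x) = - e (T x) := by
    rw [hT, LinearMap.add_apply, LinearMap.add_apply, hT₁e, hδe, map_add, neg_add]
  have hTc (x) : T (c x) = c (T x) := by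
    rw [hT, LinearMap.add_apply, LinearMap.add_apply, hδN _ ⟨x, rfl⟩, map_add, hcδ, hγx]
    abel
  -- A complement `K'` of `N ⊓ K` in `K`, and a complement `L` of `K'` containing `N`.
  obtain ⟨Z, hZe, hZ⟩ := exists_isCompl_mem_invtSubmodule h2 hβ0 e he (p := N ⊓ K)
    fun x hx => ⟨heN x hx.1, heK x hx.2⟩
  obtain ⟨Y, hYe, hY⟩ := exists_isCompl_mem_invtSubmodule h2 hβ0 e he (p := N ⊔ K) (by
    intro x hx
    obtain ⟨y, hy, z, hz, rfl⟩ := Submodule.mem_sup.1 hx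
    rw [map_add]
    exact Submodule.add_mem_sup (heN y hy) (heK z hz))
  set K' := Z ⊓ K with hK'
  set L := N ⊔ Y with hL
  have hK'e : ∀ x ∈ K', e x ∈ K' := fun x hx => ⟨hZe x hx.1, heK x hx.2⟩
  have hLe : ∀ x ∈ L, e x ∈ L := by
    intro x hx
    obtain ⟨y, hy, z, hz, rfl⟩ := Submodule.mem_sup.1 hx
    rw [map_add]
    exact Submodule.add_mem_sup (heN y hy) (hYe z hz)
  have hLK : L ⊓ K = N ⊓ K := by
    refine le_antisymm ?_ (inf_le_inf_right _ le_sup_left)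
    have h1 : L ⊓ (N ⊔ K) = N := by
      rw [hL, sup_inf_assoc_of_le Y (le_sup_left : N ≤ N ⊔ K), inf_comm Y, hY.inf_eq_bot,
        sup_bot_eq]
    refine le_inf ?_ inf_le_right
    exact (le_inf inf_le_left (inf_le_right.trans le_sup_right)).trans h1.le
  have hKeq : (N ⊓ K) ⊔ K' = K := by
    rw [hK', ← sup_inf_assoc_of_le Z inf_le_right, hZ.sup_eq_top, top_inf_eq]
  have hK'L : IsCompl K' L := by
    refine ⟨disjoint_iff.2 ?_, codisjoint_iff.2 ?_⟩
    · rw [eq_bot_iff]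
      have h1 : K' ⊓ L ≤ N ⊓ K := by
        rw [← hLK]
        exact le_inf inf_le_right (inf_le_left.trans inf_le_right)
      have h3 : K' ⊓ L ≤ Z := inf_le_left.trans inf_le_left
      exact (le_inf h1 h3).trans hZ.inf_eq_bot.le
    · have h1 : K' ⊔ L = (N ⊔ K) ⊔ Y := by
        rw [hL, ← hKeq]
        refine le_antisymm ?_ ?_
        · exact sup_le (le_sup_of_le_left (le_sup_of_le_right le_sup_right))
            (sup_le_sup_right le_sup_left _)
        · refine sup_le (sup_le ?_ (sup_le ?_ le_sup_left)) ?_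
          · exact le_sup_of_le_right le_sup_left
          · exact inf_le_left.trans (le_sup_of_le_right le_sup_left)
          · exact le_sup_of_le_right le_sup_right
      rw [h1, hY.sup_eq_top]
  set J := K'.projectionOnto L hK'L with hJ
  have hJL (x) (hx : x ∈ L) : J x = 0 := Submodule.projectionOnto_apply_of_mem_right _ hx
  have hJK' (x) (hx : x ∈ K') : J x = ⟨x, hx⟩ :=
    Submodule.projectionOnto_apply_of_mem_left _ hx
  have hdec (x : M) : ∃ y ∈ K', ∃ z ∈ L, x = y + z := by
    have hx : x ∈ K' ⊔ L := hK'L.sup_eq_top ▸ Submodule.mem_top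
    obtain ⟨y, hy, z, hz, rfl⟩ := Submodule.mem_sup.1 hx
    exact ⟨y, hy, z, hz, rfl⟩
  obtain ⟨τ, hττ, hτe⟩ := exists_involutive_anticommuting hβ (e.restrict hK'e)
    (fun x => Subtype.ext (he x))
  have hτe' (x : K') : (τ ⟨e x, hK'e x x.2⟩ : M) = - e (τ x) := congrArg Subtype.val (hτe x)
  set T' : Module.End k M := T - T ∘ₗ K'.subtype ∘ₗ J + K'.subtype ∘ₗ τ ∘ₗ J with hT'
  have hT'L (x) (hx : x ∈ L) : T' x = T x := by
    simp [hT', hJL x hx, -Submodule.coe_projectionOnto_apply]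
  have hT'K' (x) (hx : x ∈ K') : T' x = τ ⟨x, hx⟩ := by
    simp [hT', hJK' x hx, -Submodule.coe_projectionOnto_apply]
  have hT'N (x) (hx : x ∈ N) : T' x = t₀ ⟨x, hx⟩ := by
    rw [hT'L x (Submodule.mem_sup_left hx), hTN x hx]
  have hcK' (x) (hx : x ∈ K') : c x = 0 := hx.2
  have hT'c (x) : T' (c x) = c (T' x) := by
    obtain ⟨y, hy, z, hz, rfl⟩ := hdec x
    rw [map_add T', hT'K' y hy, hT'L z hz, map_add c, map_add c, hcK' y hy, hcK' _ (τ _).2, zero_add,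
      zero_add, ← hTc, hT'L _ (Submodule.mem_sup_left ⟨z, rfl⟩)]
  refine ⟨T', ?_, hT'c, ?_⟩
  · rw [injective_iff_map_eq_zero]
    intro x hx
    have hcx : c x = 0 := by
      have h1 : T' (c x) = 0 := by rw [hT'c, hx, map_zero]
      rw [hT'N _ ⟨x, rfl⟩, Submodule.coe_eq_zero, map_eq_zero_iff _ ht₀inj] at h1
      exact congrArg Subtype.val h1
    obtain ⟨y, hy, z, hz, rfl⟩ := Submodule.mem_sup.1 (hKeq.ge (LinearMap.mem_ker.2 hcx))
    rw [map_add, hT'N y hy.1, hT'K' z hz] at hx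
    have h1 : (τ ⟨z, hz⟩ : M) ∈ N := by
      rw [eq_neg_of_add_eq_zero_right hx]
      exact N.neg_mem (t₀ _).2
    have h3 : (τ ⟨z, hz⟩ : M) = 0 :=
      Submodule.disjoint_def.1 hK'L.disjoint _ (τ _).2 (Submodule.mem_sup_left h1)
    rw [h3, add_zero, Submodule.coe_eq_zero, map_eq_zero_iff _ ht₀inj] at hx
    have hz0 : (⟨z, hz⟩ : K') = 0 := by
      rw [← hττ ⟨z, hz⟩, Subtype.ext (a1 := τ ⟨z, hz⟩) (a2 := 0) h3, map_zero]
    rw [show y = 0 from congrArg Subtype.val hx, show z = 0 from congrArg Subtype.val hz0, add_zero]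
  · intro x
    obtain ⟨y, hy, z, hz, rfl⟩ := hdec x
    rw [map_add e, map_add, map_add, hT'K' y hy, hT'L z hz, hT'K' _ (hK'e y hy),
      hT'L _ (hLe z hz), hτe' ⟨y, hy⟩, hTe, map_add, neg_add]

end Swap

section FiniteField

theorem exists_pow_isIdempotentElem {A : Type*} [Monoid A] [Finite A] (c : A) :
    ∃ n, 0 < n ∧ c ^ n * c ^ n = c ^ n := by
  obtain ⟨a, b, hne, hab⟩ := Finite.exists_ne_map_eq_of_infinite (fun n : ℕ => c ^ n)
  wlog hlt : a < b generalizing a b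
  · exact this b a hne.symm hab.symm (by omega)
  obtain ⟨r, rfl⟩ := Nat.exists_eq_add_of_lt hlt
  have hstep (m l : ℕ) : c ^ (a + m + l * (r + 1)) = c ^ (a + m) := by
    induction l with
    | zero => simp
    | succ l ih =>
      rw [← ih, show a + m + (l + 1) * (r + 1) = (a + r + 1) + (m + l * (r + 1)) by ring, pow_add,
        ← show c ^ a = c ^ (a + r + 1) from hab, ← pow_add]
      congr 1; ring
  refine ⟨(a + 1) * (r + 1), by positivity, ?_⟩
  have h := hstep ((a + 1) * (r + 1) - a) (a + 1)
  have hle : a ≤ (a + 1) * (r + 1) := by nlinarith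
  rwa [Nat.add_sub_cancel' hle, pow_add] at h

variable {k M : Type*} [Field k] [AddCommGroup M] [Module k M] [FiniteDimensional k M]

/-- The swap automorphism for an anticommuting pair `c`, `d` with `c` nilpotent. -/
theorem exists_commuting_anticommuting_of_nilpotent [Fintype k] (hq : Odd (Fintype.card k))
    (h2 : (2 : k) ≠ 0) {β : k} (hβ : ¬ IsSquare β) (c d : Module.End k M) (hcd : c * d = - (d * c))
    (hsum : c * c + d * d = algebraMap k _ β) {n : ℕ} (hn : c ^ n = 0) :
    ∃ t : Module.End k M, Function.Injective t ∧ t * c = c * t ∧ t * d = - (d * t) := by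
  have hβ0 : β ≠ 0 := fun h => hβ (h ▸ IsSquare.zero)
  set q := Fintype.card k
  set Q := q ^ n with hQ
  obtain ⟨j, hj⟩ : Odd Q := hq.pow
  set u := d * d with hu
  have hu' : u = algebraMap k _ β - c * c := by rw [← hsum]; abel
  have hcomm {t : Module.End k M} (h : t * c = c * t) : Commute t u := by
    rw [hu']
    have : Commute t c := h
    exact (Algebra.commute_algebraMap_right β t).sub_right (this.mul_right this)
  have hdu : Commute d u := (Commute.refl d).mul_right (Commute.refl d)
  have huQ : u ^ Q = algebraMap k _ β := by
    obtain ⟨p, hp⟩ := CharP.exists k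
    obtain ⟨f, hpp, hf⟩ := FiniteField.card k p
    have : Fact p.Prime := ⟨hpp⟩
    have h1 : (Polynomial.C β - Polynomial.X) ^ Q = Polynomial.C β - Polynomial.X ^ Q := by
      have hQp : Q = p ^ ((f : ℕ) * n) := by rw [hQ, pow_mul, ← hf]
      rw [hQp, sub_pow_char_pow, ← hQp, ← Polynomial.C_pow, hQ, FiniteField.pow_card_pow]
    have h3 := congrArg (Polynomial.aeval (c * c)) h1
    have h4 : (c * c) ^ Q = 0 := by
      have hnQ : n ≤ Q := (Nat.lt_pow_self (Fintype.one_lt_card)).le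
      rw [(Commute.refl c).mul_pow, pow_eq_zero_of_le hnQ hn, zero_mul]
    simpa [h4, ← hu'] using h3
  have huunit : IsUnit u := by
    have : IsUnit (u ^ Q) := huQ ▸ (IsUnit.mk0 β hβ0).map (algebraMap k _)
    exact (isUnit_pow_iff (by omega)).1 this
  set e := d * u ^ j with he
  have hee : e * e = algebraMap k _ β := by
    rw [← huQ, he, hj, mul_assoc, ← mul_assoc (u ^ j), ← (hdu.pow_right j).eq, mul_assoc d,
      ← mul_assoc, ← hu, ← pow_add, ← pow_succ']
    congr 1; omega
  have hce : c * e = - (e * c) := by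
    rw [he, ← mul_assoc, hcd, neg_mul, mul_assoc, mul_assoc,
      ((hcomm rfl).pow_right j).eq]
  obtain ⟨t, htinj, htc, hte⟩ := exists_commuting_anticommuting h2 hβ _ M e c rfl
    (fun x => by rw [← Module.End.mul_apply, hee, Module.algebraMap_end_apply])
    (fun x => LinearMap.congr_fun hce x)
  have htc' : t * c = c * t := LinearMap.ext htc
  refine ⟨t, htinj, htc', (huunit.pow j).mul_right_cancel ?_⟩
  have hte' : t * e = - (e * t) := LinearMap.ext hte
  rw [mul_assoc, ← he, hte', he, neg_mul, mul_assoc, mul_assoc, ((hcomm htc').pow_right j).eq]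

/-- An anticommuting pair `c`, `d` with `c² + d²` a non-square scalar is conjugate
to `c`, `-d`. -/
theorem exists_conj_neg [Fintype k] (hq : Odd (Fintype.card k))
    (h2 : (2 : k) ≠ 0) {β : k} (hβ : ¬ IsSquare β) (c d : Module.End k M) (hcd : c * d = - (d * c))
    (hsum : c * c + d * d = algebraMap k _ β) :
    ∃ t : Module.End k M, Function.Injective t ∧ t * c = c * t ∧ t * d = - (d * t) := by
  have : Finite M := Module.finite_of_finite k
  have : Finite (Module.End k M) := DFunLike.finite _
  obtain ⟨n, hn, hidem⟩ := exists_pow_isIdempotentElem c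
  set f := c ^ n with hf
  have hfc : Commute f c := (Commute.refl c).pow_left n
  have hfd : Commute f d := by
    have : Commute (c * c) d := by
      change _ = _
      rw [mul_assoc, hcd, mul_neg, ← mul_assoc, hcd, neg_mul, neg_neg, mul_assoc]
    have h := this.pow_left n
    rwa [(Commute.refl c).mul_pow, hidem] at h
  have hff (x) : f (f x) = f x := LinearMap.congr_fun hidem x
  have hfc' (x) : f (c x) = c (f x) := LinearMap.congr_fun hfc.eq x
  have hfd' (x) : f (d x) = d (f x) := LinearMap.congr_fun hfd.eq x
  have hcd' (x) : c (d x) = - d (c x) := LinearMap.congr_fun hcd x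
  set N := LinearMap.ker f
  have hcN : ∀ x ∈ N, c x ∈ N := fun x hx => by
    rw [LinearMap.mem_ker] at hx ⊢
    rw [hfc', hx, map_zero]
  have hdN : ∀ x ∈ N, d x ∈ N := fun x hx => by
    rw [LinearMap.mem_ker] at hx ⊢
    rw [hfd', hx, map_zero]
  obtain ⟨t₀, ht₀inj, ht₀c, ht₀d⟩ := exists_commuting_anticommuting_of_nilpotent hq h2 hβ
    (c.restrict hcN) (d.restrict hdN) (LinearMap.ext fun x => Subtype.ext (hcd' x))
    (LinearMap.ext fun x => Subtype.ext (LinearMap.congr_fun hsum x)) (n := n) (by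
      rw [Module.End.pow_restrict]
      exact LinearMap.ext fun x => Subtype.ext x.2)
  have ht₀c' (x : N) : (t₀ ⟨c x, hcN x x.2⟩ : M) = c (t₀ x) :=
    congrArg Subtype.val (LinearMap.congr_fun ht₀c x)
  have ht₀d' (x : N) : (t₀ ⟨d x, hdN x x.2⟩ : M) = - d (t₀ x) :=
    congrArg Subtype.val (LinearMap.congr_fun ht₀d x)
  have hg (x) : (1 - f) x ∈ N := by simp [N, hff]
  set g : M →ₗ[k] N := (1 - f).codRestrict N hg
  have hgc (x) : g (c x) = ⟨c (g x), hcN _ (g x).2⟩ := Subtype.ext (by simp [g, hfc'])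
  have hgd (x) : g (d x) = ⟨d (g x), hdN _ (g x).2⟩ := Subtype.ext (by simp [g, hfd'])
  set t : Module.End k M := c ∘ₗ f + N.subtype ∘ₗ t₀ ∘ₗ g
  have ht (x) : t x = c (f x) + t₀ (g x) := rfl
  refine ⟨t, ?_, LinearMap.ext fun x => ?_, LinearMap.ext fun x => ?_⟩
  · rw [injective_iff_map_eq_zero]
    intro x hx
    have h0 : f (t₀ (g x)) = 0 := (t₀ (g x)).2
    have h1 : c (f x) = 0 := by
      have := congrArg f hx
      rwa [ht, map_add, h0, hfc', hff, add_zero, map_zero] at this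
    have h3 : f x = 0 := by
      obtain ⟨m, rfl⟩ := Nat.exists_eq_succ_of_ne_zero hn.ne'
      have h (y) : f y = (c ^ m) (c y) := LinearMap.congr_fun (hf.trans (pow_succ c m)) y
      rw [← hff, h (f x), h1, map_zero]
    rw [ht, h1, zero_add, Submodule.coe_eq_zero, map_eq_zero_iff _ ht₀inj] at hx
    have h4 : x - f x = 0 := congrArg Subtype.val hx
    rwa [h3, sub_zero] at h4
  · rw [Module.End.mul_apply, Module.End.mul_apply, ht, ht, hgc, ht₀c', map_add, hfc']
  · rw [LinearMap.neg_apply, Module.End.mul_apply, Module.End.mul_apply, ht, ht, hgd, ht₀d',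
      map_add, hfd', hcd', neg_add]

/-- Two endomorphisms with square a common non-square scalar can be swapped by conjugation. -/
theorem exists_conj_swap [Fintype k] (hq : Odd (Fintype.card k)) (h2 : (2 : k) ≠ 0) {α : k}
    (hα : ¬ IsSquare α) (a b : Module.End k M) (ha : a * a = algebraMap k _ α)
    (hb : b * b = algebraMap k _ α) :
    ∃ t : Module.End k M, Function.Injective t ∧ t * a = b * t ∧ t * b = a * t := by
  have h4 : ¬ IsSquare (2 * 2 * α) := by
    rintro ⟨r, hr⟩
    refine hα ⟨r / 2, ?_⟩
    field_simp
    linear_combination hr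
  obtain ⟨t, ht, h₁, h₃⟩ := exists_conj_neg hq h2 h4 (a + b) (a - b)
    (by simp only [add_mul, mul_add, sub_mul, mul_sub, ha, hb]; abel)
    (by
      simp only [add_mul, mul_add, sub_mul, mul_sub, ha, hb, map_mul, map_ofNat]
      noncomm_ring)
  have hcancel {x y : Module.End k M} (h : (2 : k) • x = (2 : k) • y) : x = y :=
    smul_right_injective _ h2 h
  rw [mul_add, add_mul] at h₁
  rw [mul_sub, sub_mul] at h₃
  refine ⟨t, ht, hcancel ?_, hcancel ?_⟩
  · rw [two_smul, two_smul]
    linear_combination (norm := abel) h₁ + h₃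
  · rw [two_smul, two_smul]
    linear_combination (norm := abel) h₁ - h₃

end FiniteField

section GeneralLinear

variable {n k : Type*} [Fintype n] [DecidableEq n] [Field k]

/-- Every square matrix over a field is similar to its transpose. -/
theorem exists_mul_eq_transpose_mul (A : Matrix n n k) :
    ∃ T : GL n k, (T : Matrix n n k) * A = Aᵀ * (T : Matrix n n k) := by
  obtain ⟨B, hB⟩ := exists_equiv_dual_selfAdjoint (toLin' A)
  let b := Pi.basisFun k n
  let T := LinearMap.toMatrix b b.dualBasis (B : (n → k) →ₗ[k] Module.Dual k (n → k))
  let T' := LinearMap.toMatrix b.dualBasis b (B.symm : Module.Dual k (n → k) →ₗ[k] (n → k))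
  refine ⟨⟨T, T', ?_, ?_⟩, ?_⟩
  · rw [← LinearMap.toMatrix_comp b.dualBasis b b.dualBasis, LinearEquiv.comp_symm,
      LinearMap.toMatrix_id]
  · rw [← LinearMap.toMatrix_comp b b.dualBasis b, LinearEquiv.symm_comp,
      LinearMap.toMatrix_id]
  · have hA : A = LinearMap.toMatrix b b (toLin' A) := (LinearMap.toMatrix'_toLin' A).symm
    change T * A = Aᵀ * T
    rw [hA, ← LinearMap.toMatrix_transpose, ← LinearMap.toMatrix_comp b b b.dualBasis,
      ← LinearMap.toMatrix_comp b b.dualBasis b.dualBasis]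
    congr 1
    exact LinearMap.ext fun x => LinearMap.ext fun y => hB x y

/-- Transposition as a map on the general linear group. -/
def transposeGL (g : GL n k) : GL n k where
  val := (g : Matrix n n k)ᵀ
  inv := ((g⁻¹ : GL n k) : Matrix n n k)ᵀ
  val_inv := by rw [← transpose_mul, Units.inv_mul, transpose_one]
  inv_val := by rw [← transpose_mul, Units.mul_inv, transpose_one]

theorem transposeGL_mul (g h : GL n k) : transposeGL (g * h) = transposeGL h * transposeGL g :=
  Units.ext (transpose_mul _ _)

theorem transposeGL_transposeGL (g : GL n k) : transposeGL (transposeGL g) = g :=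
  Units.ext (transpose_transpose _)

theorem trace_transposeGL {R V : Type*} [Field R] [AddCommGroup V] [Module R V]
    (π : Representation R (GL n k) V) (g : GL n k) :
    LinearMap.trace R V (π (transposeGL g)) = LinearMap.trace R V (π g) := by
  obtain ⟨T, hT⟩ := exists_mul_eq_transpose_mul (g : Matrix n n k)
  have h : transposeGL g = T * g * T⁻¹ := by
    rw [eq_mul_inv_iff_mul_eq]
    exact Units.ext hT.symm
  rw [h, map_mul, LinearMap.trace_mul_comm, ← map_mul, inv_mul_cancel_left]

end GeneralLinear

section TwistedLinear

variable {k : Type*} [Field k] {m : ℕ}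

/-- The matrix whose centralizer in `GL_{2m}(𝒌)` is the twisted-linear subgroup. -/
def twistMatrix (m : ℕ) (α : k) : Matrix (Fin m ⊕ Fin m) (Fin m ⊕ Fin m) k :=
  fromBlocks 0 1 (α • 1) 0

theorem twistMatrix_mul_self (α : k) :
    twistMatrix m α * twistMatrix m α = algebraMap k (Matrix (Fin m ⊕ Fin m) _ k) α := by
  rw [twistMatrix, fromBlocks_multiply, Algebra.algebraMap_eq_smul_one, ← fromBlocks_one,
    fromBlocks_smul]
  simp

theorem isTwistedLinear_iff_commute {α : k} {h : GL (Fin m ⊕ Fin m) k} :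
    IsTwistedLinear α h ↔ Commute (twistMatrix m α) (h : Matrix (Fin m ⊕ Fin m) _ k) := by
  constructor
  · rintro ⟨x, y, hxy⟩
    rw [hxy]
    simp [Commute, SemiconjBy, twistMatrix, fromBlocks_multiply]
  · intro hc
    have h' := hc.eq
    rw [← fromBlocks_toBlocks (h : Matrix (Fin m ⊕ Fin m) (Fin m ⊕ Fin m) k), twistMatrix,
      fromBlocks_multiply, fromBlocks_multiply, fromBlocks_inj] at h'
    simp only [zero_mul, one_mul, mul_zero, mul_one, zero_add, add_zero, Matrix.smul_mul, Matrix.mul_smul]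
      at h'
    obtain ⟨h₁, h₂, -, -⟩ := h'
    refine ⟨toBlocks₁₁ h.1, toBlocks₁₂ h.1, ?_⟩
    rw [← h₁]
    exact (fromBlocks_toBlocks h.1).symm.trans (by rw [h₂])

theorem IsTwistedLinear.inv {α : k} {h : GL (Fin m ⊕ Fin m) k} (hh : IsTwistedLinear α h) :
    IsTwistedLinear α h⁻¹ := by
  rw [isTwistedLinear_iff_commute] at hh ⊢
  exact hh.units_inv_right

/-- Every double coset of the twisted-linear subgroup is stable under inversion. -/
theorem exists_isTwistedLinear_inv_eq [Fintype k] (hq : Odd (Fintype.card k)) {α : k}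
    (hα : ¬ IsSquare α) (g : GL (Fin m ⊕ Fin m) k) :
    ∃ h h', IsTwistedLinear α h ∧ IsTwistedLinear α h' ∧ g⁻¹ = h' * g * h := by
  have h2 : (2 : k) ≠ 0 := Ring.two_ne_zero fun h => by
    have := FiniteField.even_card_iff_char_two.1 h
    exact Nat.not_even_iff_odd.2 hq (Nat.even_iff.2 this)
  set J := twistMatrix m α with hJ
  let φ := toLinAlgEquiv' (R := k) (n := Fin m ⊕ Fin m)
  let A : Matrix (Fin m ⊕ Fin m) (Fin m ⊕ Fin m) k := g.1 * J * g⁻¹.1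
  have hA : A * A = algebraMap k _ α := by
    have : A * A = g.1 * (J * J) * g⁻¹.1 := by
      simp only [A, mul_assoc]
      rw [← mul_assoc g⁻¹.1 g.1, Units.inv_mul, one_mul]
    rw [this, twistMatrix_mul_self, ← Algebra.commutes, mul_assoc, Units.mul_inv, mul_one]
  obtain ⟨t, ht, h₁, h₃⟩ := exists_conj_swap hq h2 hα (φ J) (φ A)
    (by rw [← map_mul, twistMatrix_mul_self, AlgEquiv.commutes])
    (by rw [← map_mul, hA, AlgEquiv.commutes])
  obtain ⟨T, rfl⟩ := φ.surjective t
  have hT : IsUnit T := by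
    rw [← MulEquiv.isUnit_map φ, Module.End.isUnit_iff]
    exact ⟨ht, LinearMap.injective_iff_surjective.1 ht⟩
  obtain ⟨T, rfl⟩ := hT
  rw [← map_mul, ← map_mul, φ.injective.eq_iff] at h₁ h₃
  have hg : g⁻¹.1 * g.1 = 1 := Units.inv_mul g
  have hAg : A * g.1 = g.1 * J := by rw [mul_assoc, hg, mul_one]
  have hgA : g⁻¹.1 * A = J * g⁻¹.1 := by rw [← mul_assoc, ← mul_assoc, hg, one_mul]
  refine ⟨g⁻¹ * T, (T * g)⁻¹, ?_, IsTwistedLinear.inv ?_, by group⟩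
  · rw [isTwistedLinear_iff_commute]
    change J * (g⁻¹.1 * T.1) = g⁻¹.1 * T.1 * J
    rw [mul_assoc, h₁, ← mul_assoc, ← mul_assoc, hgA]
  · rw [isTwistedLinear_iff_commute]
    change J * (T.1 * g.1) = T.1 * g.1 * J
    rw [mul_assoc, ← hAg, ← mul_assoc, ← mul_assoc, h₃]

/-- The involution swapping the two blocks of coordinates. -/
def blockSwap (m : ℕ) (k : Type*) [Field k] : GL (Fin m ⊕ Fin m) k where
  val := fromBlocks 0 1 1 0
  inv := fromBlocks 0 1 1 0
  val_inv := by simp [fromBlocks_multiply]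
  inv_val := by simp [fromBlocks_multiply]

theorem IsTwistedLinear.exists_mul_blockSwap {α : k} {h : GL (Fin m ⊕ Fin m) k}
    (hh : IsTwistedLinear α h) :
    ∃ h', IsTwistedLinear α h' ∧ h * blockSwap m k = blockSwap m k * transposeGL h' := by
  refine ⟨transposeGL ((blockSwap m k)⁻¹ * h * blockSwap m k), ?_, ?_⟩
  · obtain ⟨x, y, hxy⟩ := hh
    refine ⟨xᵀ, yᵀ, ?_⟩
    change ((fromBlocks 0 1 1 0 : Matrix (Fin m ⊕ Fin m) (Fin m ⊕ Fin m) k) * h.1 *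
      fromBlocks 0 1 1 0)ᵀ = _
    simp [hxy, fromBlocks_multiply, fromBlocks_transpose]
  · rw [transposeGL_transposeGL]
    group

end TwistedLinear

/-- **The twisted-linear pair is a Gelfand pair.**  Over an algebraically closed field
`R` of characteristic different from that of `𝒌` (with `q` odd), an irreducible
`H`-distinguished representation of `GL_{2m}(𝒌)` has a one-dimensional space of
`H`-invariant linear forms and is self-dual. -/
theorem twisted_linear_gelfand_pair [IsAlgClosed R] [FiniteDimensional R V]
    (hq : Odd (Fintype.card k)) (hchar : ringChar R ≠ ringChar k)
    (α : k) (hα0 : α ≠ 0) (hα : ¬ IsSquare α)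
    (π : Representation R (GL (Fin m ⊕ Fin m) k) V)
    (hV : ∃ v : V, v ≠ 0)
    (hirr : ∀ W : Submodule R V, (∀ (g : GL (Fin m ⊕ Fin m) k), ∀ v ∈ W, π g v ∈ W) →
      W = ⊥ ∨ W = ⊤)
    (hdist : ∃ Λ : Module.Dual R V, Λ ≠ 0 ∧ Λ ∈ invForms π (IsTwistedLinear α)) :
    Module.finrank R (invForms π (IsTwistedLinear α)) = 1 ∧
      ∃ e : V ≃ₗ[R] Module.Dual R V, ∀ (g : GL (Fin m ⊕ Fin m) k) (v : V),
        e (π g v) = π.dual g (e v) := by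
  obtain ⟨Λ, hΛ, hΛH⟩ := hdist
  have hspan := linearCombination_surjective_of_irreducible π hV hirr
  obtain ⟨w₀, hw₀, hw₀H⟩ := exists_invariant_vector π hspan transposeGL_mul
    transposeGL_transposeGL (trace_transposeGL π) hΛ hΛH
  set w := π (blockSwap m k) w₀ with hw
  have hw0 : w ≠ 0 := fun h => hw₀ (by
    have := π.inv_self_apply (blockSwap m k) w₀
    rwa [← hw, h, map_zero, eq_comm] at this)
  have hwH (h) (hh : IsTwistedLinear α h) : π h w = w := by
    obtain ⟨h', hh', he⟩ := hh.exists_mul_blockSwap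
    rw [hw, ← Module.End.mul_apply, ← map_mul, he, map_mul, Module.End.mul_apply, hw₀H h' hh']
  have key (Λ' : Module.Dual R V) (h0 : Λ' ≠ 0) (hH : Λ' ∈ invForms π (IsTwistedLinear α)) :
      ∃ e : V ≃ₗ[R] Module.Dual R V, (∀ g v, e (π g v) = π.dual g (e v)) ∧ e w = Λ' := by
    refine exists_equiv_dual π hirr hw0 h0 fun g => ?_
    obtain ⟨h, h', hh, hh', hg⟩ := exists_isTwistedLinear_inv_eq hq hα g
    rw [hg, map_mul, map_mul, Module.End.mul_apply, Module.End.mul_apply, hwH h hh, hH h' hh']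
  obtain ⟨e, he, hew⟩ := key Λ hΛ hΛH
  refine ⟨?_, e, he⟩
  rw [finrank_eq_one_iff_of_nonzero' (⟨Λ, hΛH⟩ : invForms π (IsTwistedLinear α))
    (fun h => hΛ (congrArg Subtype.val h))]
  rintro ⟨Λ', hH⟩
  by_cases h0 : Λ' = 0
  · exact ⟨0, Subtype.ext (by simp [h0])⟩
  · obtain ⟨e', he', hew'⟩ := key Λ' h0 hH
    obtain ⟨c, hc⟩ := exists_smul_eq_of_equivariant π hV hirr π.dual e' e he' he
    exact ⟨c, Subtype.ext ((congrArg (c • ·) hew).symm.trans ((hc w).symm.trans hew'))⟩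

end Stmt18
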